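/- arXiv:1911.10257 — 2 statements merged into one kernel-verified Lean document; each statement's English description precedes it below -/
import Mathlib

section
/- Let (φ, φ₂, φ₀) be a coherent G-action on a category C, let h : π → G be a group homomorphism, and let (u, U) be an abstract precoloring over h. Then for every κ ∈ G the conjugated data (u^κ, U^κ) is an abstract precoloring over the conjugated homomorphism h^κ, i.e. it satisfies conditions (P1) and (P2) with h replaced by h^κ. (This is the algebraic content, at a fixed arc, of the claim that the conjugation of a B-colored G-graph by an element κ of G yields a B-precoloring of the conjugated G-graph.) -/
open CategoryTheory

universe v u

/-- A coherent `G`-action on a category `C`: functors `φ g : C ⥤ C`, natural isomorphisms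
`φ₂ a b X : φ_a(φ_b(X)) ≅ φ_{ba}(X)` and `φ₀ X : X ≅ φ₁(X)`, satisfying (A1), (A1'), (A2). -/
structure CoherentAction (G : Type*) [Group G] (C : Type u) [Category.{v} C] where
  φ : G → C ⥤ C
  φ₂ : ∀ (a b : G) (X : C), (φ a).obj ((φ b).obj X) ≅ (φ (b * a)).obj X
  φ₂_natural :
    ∀ (a b : G) {X Y : C} (f : X ⟶ Y),
      (φ a).map ((φ b).map f) ≫ (φ₂ a b Y).hom = (φ₂ a b X).hom ≫ (φ (b * a)).map f
  φ₀ : ∀ X : C, X ≅ (φ 1).obj X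
  φ₀_natural : ∀ {X Y : C} (f : X ⟶ Y), f ≫ (φ₀ Y).hom = (φ₀ X).hom ≫ (φ 1).map f
  A1 : ∀ (a : G) (X : C),
    (φ₂ 1 a X).hom ≫ eqToHom (by rw [mul_one]) = (φ₀ ((φ a).obj X)).inv
  A1' : ∀ (a : G) (X : C),
    (φ₂ a 1 X).hom ≫ eqToHom (by rw [one_mul]) = (φ a).map (φ₀ X).inv
  A2 : ∀ (a b c : G) (X : C),
    (φ₂ a b ((φ c).obj X)).hom ≫ (φ₂ (b * a) c X).hom =
      (φ a).map (φ₂ b c X).hom ≫ (φ₂ a (c * b) X).hom ≫ eqToHom (by rw [mul_assoc])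

variable {G : Type*} [Group G] {C : Type u} [Category.{v} C] {π : Type*} [Group π]

/-- The pair `(u, U)` is an abstract precoloring over the group homomorphism `h : π →* G`:
condition (P1) says `U_{1,γ} = (φ₀)_{u(γ)}`, and condition (P2) says
`U_{βδ,γ} = φ₂(h(β)⁻¹, h(δ)⁻¹)_{u(γ)} ∘ φ_{h(β)⁻¹}(U_{δ,γ}) ∘ U_{β,δγ}`
(with the canonical identifications given by `eqToHom`). -/
def IsPrecoloring (A : CoherentAction G C) (h : π →* G) (u : π → C)
    (U : ∀ β γ : π, u (β * γ) ≅ (A.φ (h β)⁻¹).obj (u γ)) : Prop :=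
  (∀ γ : π, (U 1 γ).hom =
      eqToHom (by rw [one_mul]) ≫ (A.φ₀ (u γ)).hom ≫ eqToHom (by rw [map_one, inv_one])) ∧
  (∀ β δ γ : π, (U (β * δ) γ).hom =
      eqToHom (by rw [mul_assoc]) ≫ (U β (δ * γ)).hom ≫
        (A.φ (h β)⁻¹).map (U δ γ).hom ≫ (A.φ₂ (h β)⁻¹ (h δ)⁻¹ (u γ)).hom ≫
        eqToHom (by rw [map_mul, mul_inv_rev]))

/-- The objects `u(γ) = φ_{h(γ)⁻¹}(u₀)` constructed from a single object `u₀`. -/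
def canonObj (A : CoherentAction G C) (h : π →* G) (u₀ : C) : π → C :=
  fun γ => (A.φ (h γ)⁻¹).obj u₀

/-- The isomorphisms `U_{β,γ} = (φ₂(h(β)⁻¹, h(γ)⁻¹)_{u₀})⁻¹ : u(βγ) ≅ φ_{h(β)⁻¹}(u(γ))`
constructed from a single object `u₀`. -/
def canonIso (A : CoherentAction G C) (h : π →* G) (u₀ : C) (β γ : π) :
    canonObj A h u₀ (β * γ) ≅ (A.φ (h β)⁻¹).obj (canonObj A h u₀ γ) :=
  eqToIso (by simp only [canonObj, map_mul, mul_inv_rev]) ≪≫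
    (A.φ₂ (h β)⁻¹ (h γ)⁻¹ u₀).symm

/-- The conjugated homomorphism `h^κ : π →* G`, `h^κ(β) = κ⁻¹ h(β) κ`. -/
def conjHom (h : π →* G) (κ : G) : π →* G where
  toFun β := κ⁻¹ * h β * κ
  map_one' := by simp
  map_mul' := fun a b => by
    show κ⁻¹ * h (a * b) * κ = (κ⁻¹ * h a * κ) * (κ⁻¹ * h b * κ)
    rw [map_mul]; group

theorem conjHom_apply (h : π →* G) (κ : G) (β : π) : conjHom h κ β = κ⁻¹ * h β * κ := rfl

/-- The conjugated objects `u^κ(γ) = φ_κ(u(γ))`. -/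
def conjObj (A : CoherentAction G C) (κ : G) (u : π → C) : π → C :=
  fun γ => (A.φ κ).obj (u γ)

/-- The conjugated isomorphisms
`(U^κ)_{β,γ} = (φ₂(κ⁻¹h(β)⁻¹κ, κ)_{u(γ)})⁻¹ ∘ φ₂(κ, h(β)⁻¹)_{u(γ)} ∘ φ_κ(U_{β,γ})`
(with the canonical identifications given by `eqToIso`). -/
def conjIso (A : CoherentAction G C) (h : π →* G) (κ : G) (u : π → C)
    (U : ∀ β γ : π, u (β * γ) ≅ (A.φ (h β)⁻¹).obj (u γ)) (β γ : π) :
    conjObj A κ u (β * γ) ≅ (A.φ ((conjHom h κ) β)⁻¹).obj (conjObj A κ u γ) :=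
  (A.φ κ).mapIso (U β γ) ≪≫ A.φ₂ κ (h β)⁻¹ (u γ) ≪≫
    eqToIso (congrArg (fun g => (A.φ g).obj (u γ))
      (show (h β)⁻¹ * κ = κ * (κ⁻¹ * (h β)⁻¹ * κ) by group)) ≪≫
    (A.φ₂ (κ⁻¹ * (h β)⁻¹ * κ) κ (u γ)).symm ≪≫
    eqToIso (congrArg (fun g => (A.φ g).obj ((A.φ κ).obj (u γ)))
      (show κ⁻¹ * (h β)⁻¹ * κ = ((conjHom h κ) β)⁻¹ by rw [conjHom_apply]; group))

namespace CoherentAction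

/-- The isomorphism `φ_a(φ_b(X)) ≅ φ_c(X)` for any `c` with a proof of `b * a = c`. -/
def comp (A : CoherentAction G C) (a b c : G) (e : b * a = c) (X : C) :
    (A.φ a).obj ((A.φ b).obj X) ≅ (A.φ c).obj X :=
  A.φ₂ a b X ≪≫ eqToIso (by rw [e])

theorem comp_natural (A : CoherentAction G C) (a b c : G) (e : b * a = c) {X Y : C} (f : X ⟶ Y) :
    (A.φ a).map ((A.φ b).map f) ≫ (A.comp a b c e Y).hom =
      (A.comp a b c e X).hom ≫ (A.φ c).map f := by
  subst e
  simp [comp, A.φ₂_natural]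

theorem comp_inv_natural (A : CoherentAction G C) (a b c : G) (e : b * a = c) {X Y : C}
    (f : X ⟶ Y) :
    (A.comp a b c e X).inv ≫ (A.φ a).map ((A.φ b).map f) =
      (A.φ c).map f ≫ (A.comp a b c e Y).inv := by
  rw [Iso.inv_comp_eq, ← Category.assoc, ← comp_natural, Category.assoc, Iso.hom_inv_id,
    Category.comp_id]

theorem comp_assoc (A : CoherentAction G C) (a b c ba cb cba : G) (e₁ : b * a = ba)
    (e₂ : c * b = cb) (e₃ : c * ba = cba) (e₄ : cb * a = cba) (X : C) :
    (A.comp a b ba e₁ ((A.φ c).obj X)).hom ≫ (A.comp ba c cba e₃ X).hom =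
      (A.φ a).map (A.comp b c cb e₂ X).hom ≫ (A.comp a cb cba e₄ X).hom := by
  subst e₁ e₂ e₃
  simp [comp, A.A2]

theorem map_unit_comp (A : CoherentAction G C) (a b : G) (hb : 1 = b) (e : b * a = a) (X : C) :
    (A.φ a).map ((A.φ₀ X).hom ≫ eqToHom (by rw [hb])) ≫ (A.comp a b a e X).hom =
      𝟙 ((A.φ a).obj X) := by
  subst hb
  simp only [comp, Iso.trans_hom, eqToIso.hom, eqToHom_refl, Category.comp_id, A.A1',
    ← Functor.map_comp, Iso.hom_inv_id]
  exact (A.φ a).map_id X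

theorem comp_unit_inv (A : CoherentAction G C) (a b : G) (hb : 1 = b) (e : a * b = a) (X : C) :
    (A.comp b a a e X).inv = (A.φ₀ ((A.φ a).obj X)).hom ≫ eqToHom (by rw [hb]) := by
  subst hb
  rw [Iso.inv_eq_inv (A.comp 1 a a e X) (A.φ₀ ((A.φ a).obj X)).symm |>.mpr]
  · simp
  · simp [comp, A.A1]

end CoherentAction

theorem conjIso_hom (A : CoherentAction G C) (h : π →* G) (κ : G) (u : π → C)
    (U : ∀ β γ : π, u (β * γ) ≅ (A.φ (h β)⁻¹).obj (u γ)) (β γ : π) (c : G)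
    (e₁ : (h β)⁻¹ * κ = c) (e₂ : κ * (conjHom h κ β)⁻¹ = c) :
    (conjIso A h κ u U β γ).hom =
      (A.φ κ).map (U β γ).hom ≫ (A.comp κ (h β)⁻¹ c e₁ (u γ)).hom ≫
        (A.comp (conjHom h κ β)⁻¹ κ c e₂ (u γ)).inv := by
  have key : ∀ (k k' c : G) (hk : k = k') (e : (h β)⁻¹ * κ = κ * k) (e₁ : (h β)⁻¹ * κ = c)
      (e₂ : κ * k' = c),
      (eqToHom (congrArg (fun g => (A.φ g).obj (u γ)) e) ≫ (A.φ₂ k κ (u γ)).inv ≫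
        eqToHom (congrArg (fun g => (A.φ g).obj ((A.φ κ).obj (u γ))) hk)) =
      eqToHom (by rw [e₁]) ≫ (A.comp k' κ c e₂ (u γ)).inv := by
    rintro k _ _ rfl e e₁ rfl
    simp [CoherentAction.comp]
  refine (congrArg (fun f => (A.φ κ).map (U β γ).hom ≫ (A.φ₂ κ (h β)⁻¹ (u γ)).hom ≫ f)
    (key (κ⁻¹ * (h β)⁻¹ * κ) _ c (by rw [conjHom_apply]; group) (by group) e₁ e₂)).trans ?_
  simp [CoherentAction.comp]

/-- the conjugated data `(u^κ, U^κ)` of an abstract precoloring `(u, U)` over `h`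
is an abstract precoloring over the conjugated homomorphism `h^κ`. -/
theorem statement3 (A : CoherentAction G C) (h : π →* G) (u : π → C)
    (U : ∀ β γ : π, u (β * γ) ≅ (A.φ (h β)⁻¹).obj (u γ))
    (hU : IsPrecoloring A h u U) (κ : G) :
    IsPrecoloring A (conjHom h κ) (conjObj A κ u) (conjIso A h κ u U) := by
  have conj_eq (β : π) : κ * (conjHom h κ β)⁻¹ = (h β)⁻¹ * κ := by
    rw [conjHom_apply]; group
  obtain ⟨h₁, h₂⟩ := hU
  refine ⟨fun γ => ?_, fun β δ γ => ?_⟩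
  · have e₁ : (h 1)⁻¹ * κ = κ := by simp
    rw [conjIso_hom A h κ u U 1 γ κ e₁ ((conj_eq 1).trans e₁), h₁, Functor.map_comp,
      Category.assoc, ← Category.assoc ((A.φ κ).map (_ ≫ _)),
      A.map_unit_comp _ _ (by simp), Category.id_comp, A.comp_unit_inv _ _ (by simp), eqToHom_map]
    rfl
  · have e₁ : (h (β * δ))⁻¹ * κ = (h δ)⁻¹ * ((h β)⁻¹ * κ) := by simp [mul_assoc]
    have e₂ : (h δ)⁻¹ * (h β)⁻¹ = (h (β * δ))⁻¹ := by simp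
    have e₃ : (conjHom h κ δ)⁻¹ * (conjHom h κ β)⁻¹ = (conjHom h κ (β * δ))⁻¹ := by simp
    have e₄ : (h δ)⁻¹ * κ * (conjHom h κ β)⁻¹ = (h δ)⁻¹ * ((h β)⁻¹ * κ) := by
      rw [mul_assoc, conj_eq]
    have hU₂ : (U (β * δ) γ).hom = eqToHom (by rw [mul_assoc]) ≫ (U β (δ * γ)).hom ≫
        (A.φ (h β)⁻¹).map (U δ γ).hom ≫ (A.comp (h β)⁻¹ (h δ)⁻¹ _ e₂ (u γ)).hom := by
      rw [h₂]; rfl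
    have a₁ := A.comp_assoc κ (h β)⁻¹ (h δ)⁻¹ _ _ _ rfl e₂ rfl e₁ (u γ)
    have a₂ := A.comp_assoc (conjHom h κ β)⁻¹ κ (h δ)⁻¹ _ _ _ (conj_eq β) rfl rfl e₄ (u γ)
    have a₃ := A.comp_assoc (conjHom h κ β)⁻¹ (conjHom h κ δ)⁻¹ κ _ _ _ e₃ (conj_eq δ)
      ((conj_eq _).trans e₁) e₄ (u γ)
    rw [conjIso_hom A h κ u U (β * δ) γ _ e₁ ((conj_eq _).trans e₁),
      conjIso_hom A h κ u U β (δ * γ) _ rfl (conj_eq β),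
      conjIso_hom A h κ u U δ γ _ rfl (conj_eq δ), hU₂]
    change _ = (eqToHom (by rw [mul_assoc]) :
        (A.φ κ).obj (u (β * δ * γ)) ⟶ (A.φ κ).obj (u (β * (δ * γ)))) ≫
      ((A.φ κ).map (U β (δ * γ)).hom ≫ (A.comp κ (h β)⁻¹ _ rfl (u (δ * γ))).hom ≫
        (A.comp (conjHom h κ β)⁻¹ κ _ (conj_eq β) (u (δ * γ))).inv) ≫
      (A.φ (conjHom h κ β)⁻¹).map ((A.φ κ).map (U δ γ).hom ≫
        (A.comp κ (h δ)⁻¹ _ rfl (u γ)).hom ≫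
        (A.comp (conjHom h κ δ)⁻¹ κ _ (conj_eq δ) (u γ)).inv) ≫
      (A.comp (conjHom h κ β)⁻¹ (conjHom h κ δ)⁻¹ _ e₃ ((A.φ κ).obj (u γ))).hom
    simp only [Functor.map_comp, eqToHom_map, Category.assoc]
    have n₁ := A.comp_inv_natural (conjHom h κ β)⁻¹ κ _ (conj_eq β) (U δ γ).hom
    have n₂ := A.comp_natural κ (h β)⁻¹ _ rfl (U δ γ).hom
    rw [reassoc_of% a₁.symm, reassoc_of% n₁, ← reassoc_of% n₂]
    congr 4
    rw [← Iso.eq_inv_comp, ← Category.assoc] at a₂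
    rw [← Category.assoc, Iso.comp_inv_eq]
    simp only [Category.assoc, a₃, a₂]
    simp only [← Functor.map_comp_assoc, Iso.inv_hom_id, Category.comp_id]
end

section
/- Let k be a field, let D be a k-linear category which is finitely semisimple with representative set of simple objects S, let E be a k-linear category with finite biproducts, and let F : Dᵒᵖ × D ⥤ E be a functor that is k-linear and additive in each variable. Then the coend of the diagram X ↦ F(X, X) exists, and the canonical dinatural morphisms ι_i : F(i, i) → ∫^{X ∈ D} F(X, X), for i ∈ S, exhibit this coend as the finite biproduct ⊕_{i ∈ S} F(i, i); in particular ∫^{X ∈ D} F(X, X) ≅ ⊕_{i ∈ S} F(i, i). (This is the decomposition of coends used in the paper to identify the relative-center coend ∫^{X} (φ_α(X))* ⊗ X with the direct sum ⊕_{J} (φ_α(J))* ⊗ J over the simple objects J.) -/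
open CategoryTheory CategoryTheory.Limits Opposite

universe v₁ v₂ u₁ u₂

/-- A family `ι X : F(X, X) ⟶ Q` is dinatural if
`ι_X ∘ F(f, id_X) = ι_Y ∘ F(id_Y, f)` for every morphism `f : X ⟶ Y`. -/
def Dinatural {D : Type u₁} [Category.{v₁} D] {E : Type u₂} [Category.{v₂} E]
    (F : Dᵒᵖ × D ⥤ E) {Q : E} (ι : ∀ X : D, F.obj (op X, X) ⟶ Q) : Prop :=
  ∀ {X Y : D} (f : X ⟶ Y),
    F.map ((f.op, 𝟙 X) : (op Y, X) ⟶ (op X, X)) ≫ ι X =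
      F.map ((𝟙 (op Y), f) : (op Y, X) ⟶ (op Y, Y)) ≫ ι Y

/-- A dinatural family `ι X : F(X, X) ⟶ Q` is a coend of `X ↦ F(X, X)` if it is universal
among dinatural families out of the diagonal of `F`. -/
def IsCoend {D : Type u₁} [Category.{v₁} D] {E : Type u₂} [Category.{v₂} E]
    (F : Dᵒᵖ × D ⥤ E) {Q : E} (ι : ∀ X : D, F.obj (op X, X) ⟶ Q) : Prop :=
  Dinatural F ι ∧
    ∀ (e : E) (η : ∀ X : D, F.obj (op X, X) ⟶ e), Dinatural F η →
      ∃! q : Q ⟶ e, ∀ X : D, η X = ι X ≫ q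

section Extension

variable {D : Type u₁} [Category.{v₁} D] [Preadditive D]
  {E : Type u₂} [Category.{v₂} E] [Preadditive E]

/-- A functor `Dᵒᵖ × D ⥤ E` that is additive in each variable. -/
structure IsBiadditive (F : Dᵒᵖ × D ⥤ E) : Prop where
  map_add_left : ∀ {X X' : D} (f f' : X ⟶ X') (Y : D),
    F.map (((f + f').op, 𝟙 Y) : (op X', Y) ⟶ (op X, Y)) =
      F.map ((f.op, 𝟙 Y) : (op X', Y) ⟶ (op X, Y)) +
        F.map ((f'.op, 𝟙 Y) : (op X', Y) ⟶ (op X, Y))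
  map_add_right : ∀ (X : Dᵒᵖ) {Y Y' : D} (g g' : Y ⟶ Y'),
    F.map ((𝟙 X, g + g') : (X, Y) ⟶ (X, Y')) =
      F.map ((𝟙 X, g) : (X, Y) ⟶ (X, Y')) + F.map ((𝟙 X, g') : (X, Y) ⟶ (X, Y'))

lemma IsBiadditive.map_sum_left {F : Dᵒᵖ × D ⥤ E} (hF : IsBiadditive F) {J : Type*} [Fintype J]
    {X X' : D} (f : J → (X ⟶ X')) (Y : D) :
    F.map (((∑ j, f j).op, 𝟙 Y) : (op X', Y) ⟶ (op X, Y)) =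
      ∑ j, F.map (((f j).op, 𝟙 Y) : (op X', Y) ⟶ (op X, Y)) :=
  map_sum (AddMonoidHom.mk' (fun f : X ⟶ X' => F.map ((f.op, 𝟙 Y) : (op X', Y) ⟶ (op X, Y)))
    fun f f' => hF.map_add_left f f' Y) f Finset.univ

lemma IsBiadditive.map_sum_right {F : Dᵒᵖ × D ⥤ E} (hF : IsBiadditive F) {J : Type*} [Fintype J]
    (X : Dᵒᵖ) {Y Y' : D} (g : J → (Y ⟶ Y')) :
    F.map ((𝟙 X, ∑ j, g j) : (X, Y) ⟶ (X, Y')) =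
      ∑ j, F.map ((𝟙 X, g j) : (X, Y) ⟶ (X, Y')) :=
  map_sum (AddMonoidHom.mk' (fun g : Y ⟶ Y' => F.map ((𝟙 X, g) : (X, Y) ⟶ (X, Y')))
    fun g g' => hF.map_add_right X g g') g Finset.univ

/-- An expression of `𝟙 X` as a finite sum of morphisms factoring through objects `s i`. -/
structure IdentityDecomposition {I : Type*} (s : I → D) (X : D) where
  /-- The number of summands. -/
  card : ℕ
  /-- The index of the object through which a summand factors. -/
  index : Fin card → I
  /-- The first factors. -/
  proj : ∀ j, X ⟶ s (index j)
  /-- The second factors. -/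
  incl : ∀ j, s (index j) ⟶ X
  total : ∑ j, proj j ≫ incl j = 𝟙 X

/-- A direct sum decomposition of `X` decomposes `𝟙 X`. -/
noncomputable def IdentityDecomposition.ofIso [HasFiniteBiproducts D] {I : Type*} {s : I → D}
    {X : D} {n : ℕ} (g : Fin n → I) (e : X ≅ ⨁ fun j => s (g j)) : IdentityDecomposition s X where
  card := n
  index := g
  proj j := e.hom ≫ biproduct.π (fun j => s (g j)) j
  incl j := biproduct.ι (fun j => s (g j)) j ≫ e.inv
  total := by
    have h := biproduct.total (f := fun j => s (g j))
    calc _ = e.hom ≫ (∑ j, biproduct.π (fun j => s (g j)) j ≫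
            biproduct.ι (fun j => s (g j)) j) ≫ e.inv := by
          simp only [Preadditive.sum_comp, Preadditive.comp_sum, Category.assoc]
      _ = 𝟙 X := by rw [h]; simp

variable {I : Type*} {s : I → D} (F : Dᵒᵖ × D ⥤ E) {Q : E}

/-- The extension to `X` of a family of morphisms `F(s i, s i) ⟶ Q`. -/
noncomputable def IdentityDecomposition.extend {X : D} (d : IdentityDecomposition s X)
    (κ : ∀ i, F.obj (op (s i), s i) ⟶ Q) : F.obj (op X, X) ⟶ Q :=
  ∑ j, F.map (((d.incl j).op, d.proj j) : (op X, X) ⟶ (op (s (d.index j)), s (d.index j))) ≫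
    κ (d.index j)

variable {F} {κ : ∀ i, F.obj (op (s i), s i) ⟶ Q}

lemma IdentityDecomposition.extend_dinatural (hF : IsBiadditive F)
    (hκ : ∀ (i j : I) (u : s i ⟶ s j),
      F.map ((u.op, 𝟙 (s i)) : (op (s j), s i) ⟶ (op (s i), s i)) ≫ κ i =
        F.map ((𝟙 (op (s j)), u) : (op (s j), s i) ⟶ (op (s j), s j)) ≫ κ j)
    (d : ∀ X, IdentityDecomposition s X) : Dinatural F fun X => (d X).extend F κ := by
  intro X Y f
  have left (j : Fin (d X).card) :
      F.map ((((d X).incl j ≫ f).op, (d X).proj j) :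
          (op Y, X) ⟶ (op (s ((d X).index j)), s ((d X).index j))) =
        ∑ l, F.map ((((d Y).incl l).op, (d X).proj j) :
            (op Y, X) ⟶ (op (s ((d Y).index l)), s ((d X).index j))) ≫
          F.map ((((d X).incl j ≫ f ≫ (d Y).proj l).op, 𝟙 _) :
            (op (s ((d Y).index l)), s ((d X).index j)) ⟶
              (op (s ((d X).index j)), s ((d X).index j))) := by
    have h : (d X).incl j ≫ f =
        ∑ l, ((d X).incl j ≫ f ≫ (d Y).proj l) ≫ (d Y).incl l := by
      simp only [Category.assoc, ← Preadditive.comp_sum, (d Y).total, Category.comp_id]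
    calc _ = F.map ((𝟙 (op Y), (d X).proj j) : (op Y, X) ⟶ (op Y, s ((d X).index j))) ≫
          F.map ((((d X).incl j ≫ f).op, 𝟙 _) : (op Y, s ((d X).index j)) ⟶
            (op (s ((d X).index j)), s ((d X).index j))) := by
          rw [← F.map_comp]; simp
      _ = _ := by
          rw [h, hF.map_sum_left, Preadditive.comp_sum]
          refine Finset.sum_congr rfl fun l _ => ?_
          rw [← F.map_comp, ← F.map_comp]
          simp
  have right (l : Fin (d Y).card) :
      F.map ((((d Y).incl l).op, f ≫ (d Y).proj l) :
          (op Y, X) ⟶ (op (s ((d Y).index l)), s ((d Y).index l))) =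
        ∑ j, F.map ((((d Y).incl l).op, (d X).proj j) :
            (op Y, X) ⟶ (op (s ((d Y).index l)), s ((d X).index j))) ≫
          F.map ((𝟙 _, (d X).incl j ≫ f ≫ (d Y).proj l) :
            (op (s ((d Y).index l)), s ((d X).index j)) ⟶
              (op (s ((d Y).index l)), s ((d Y).index l))) := by
    have h : f ≫ (d Y).proj l =
        ∑ j, (d X).proj j ≫ (d X).incl j ≫ f ≫ (d Y).proj l := by
      simp only [← Category.assoc, ← Preadditive.sum_comp, (d X).total, Category.id_comp]
    calc _ = F.map ((((d Y).incl l).op, 𝟙 X) : (op Y, X) ⟶ (op (s ((d Y).index l)), X)) ≫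
          F.map ((𝟙 _, f ≫ (d Y).proj l) : (op (s ((d Y).index l)), X) ⟶
            (op (s ((d Y).index l)), s ((d Y).index l))) := by
          rw [← F.map_comp]; simp
      _ = _ := by
          conv_lhs => rw [h, hF.map_sum_right, Preadditive.comp_sum]
          refine Finset.sum_congr rfl fun j _ => ?_
          rw [← F.map_comp, ← F.map_comp]
          simp
  calc _ = ∑ j, F.map ((((d X).incl j ≫ f).op, (d X).proj j) :
          (op Y, X) ⟶ (op (s ((d X).index j)), s ((d X).index j))) ≫ κ _ := by
        simp only [extend, Preadditive.comp_sum]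
        refine Finset.sum_congr rfl fun j _ => ?_
        rw [← Category.assoc, ← F.map_comp]
        simp
    _ = ∑ l, F.map ((((d Y).incl l).op, f ≫ (d Y).proj l) :
          (op Y, X) ⟶ (op (s ((d Y).index l)), s ((d Y).index l))) ≫ κ _ := by
        simp only [left, right, Preadditive.sum_comp, Category.assoc, hκ]
        exact Finset.sum_comm
    _ = _ := by
        simp only [extend, Preadditive.comp_sum]
        refine Finset.sum_congr rfl fun j _ => ?_
        rw [← Category.assoc, ← F.map_comp]
        simp

/-- A morphism out of `F(X, X)` that is dinatural with respect to all morphisms `s i ⟶ X` is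
the extension of the corresponding family on the objects `s i`. -/
lemma IdentityDecomposition.extend_eq (hF : IsBiadditive F) {X : D}
    (d : IdentityDecomposition s X) (η : F.obj (op X, X) ⟶ Q)
    (h : ∀ (i : I) (u : s i ⟶ X),
      F.map ((u.op, 𝟙 (s i)) : (op X, s i) ⟶ (op (s i), s i)) ≫ κ i =
        F.map ((𝟙 (op X), u) : (op X, s i) ⟶ (op X, X)) ≫ η) :
    d.extend F κ = η := by
  calc _ = ∑ j, F.map ((𝟙 (op X), d.proj j ≫ d.incl j) : (op X, X) ⟶ (op X, X)) ≫ η := by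
        refine Finset.sum_congr rfl fun j _ => ?_
        calc _ = F.map ((𝟙 (op X), d.proj j) : (op X, X) ⟶ (op X, s (d.index j))) ≫
              F.map (((d.incl j).op, 𝟙 _) : (op X, s (d.index j)) ⟶
                (op (s (d.index j)), s (d.index j))) ≫ κ (d.index j) := by
              rw [← Category.assoc, ← F.map_comp]; simp
          _ = _ := by
              rw [h, ← Category.assoc, ← F.map_comp, prod_comp, Category.comp_id]
    _ = η := by
        rw [← Preadditive.sum_comp, ← hF.map_sum_right, d.total]
        exact (congrArg (· ≫ η) (F.map_id (op X, X))).trans (Category.id_comp η)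

end Extension

/-- if `D` is a `k`-linear finitely semisimple category with representative set
of simple objects `s : ιS → D`, `E` is a `k`-linear category with finite biproducts, and
`F : Dᵒᵖ × D ⥤ E` is `k`-linear and additive in each variable, then the coend of
`X ↦ F(X, X)` exists and the canonical dinatural morphisms `F(s i, s i) → ⨁_{i} F(s i, s i)`,
given on the simple objects by the biproduct injections, exhibit the finite biproduct
`⨁_{i ∈ ιS} F(s i, s i)` as this coend. -/
theorem statement7 {k : Type*} [Field k]
    {D : Type u₁} [Category.{v₁} D] [Preadditive D] [Linear k D] [HasFiniteBiproducts D]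
    {E : Type u₂} [Category.{v₂} E] [Preadditive E] [Linear k E] [HasFiniteBiproducts E]
    {ιS : Type} [Fintype ιS] (s : ιS → D) (hinj : Function.Injective s)
    (hzero : ∀ i j : ιS, i ≠ j → ∀ f : s i ⟶ s j, f = 0)
    (hsimple : ∀ (i : ιS) (f : s i ⟶ s i), ∃! c : k, f = c • 𝟙 (s i))
    (hgen : ∀ X : D, ∃ (n : ℕ) (g : Fin n → ιS), Nonempty (X ≅ ⨁ fun j => s (g j)))
    (F : Dᵒᵖ × D ⥤ E)
    (hadd₁ : ∀ {X X' : D} (f f' : X ⟶ X') (Y : D),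
      F.map (((f + f').op, 𝟙 Y) : (op X', Y) ⟶ (op X, Y)) =
        F.map ((f.op, 𝟙 Y) : (op X', Y) ⟶ (op X, Y)) +
          F.map ((f'.op, 𝟙 Y) : (op X', Y) ⟶ (op X, Y)))
    (hsmul₁ : ∀ {X X' : D} (c : k) (f : X ⟶ X') (Y : D),
      F.map (((c • f).op, 𝟙 Y) : (op X', Y) ⟶ (op X, Y)) =
        c • F.map ((f.op, 𝟙 Y) : (op X', Y) ⟶ (op X, Y)))
    (hadd₂ : ∀ (X : Dᵒᵖ) {Y Y' : D} (g g' : Y ⟶ Y'),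
      F.map ((𝟙 X, g + g') : (X, Y) ⟶ (X, Y')) =
        F.map ((𝟙 X, g) : (X, Y) ⟶ (X, Y')) + F.map ((𝟙 X, g') : (X, Y) ⟶ (X, Y')))
    (hsmul₂ : ∀ (X : Dᵒᵖ) {Y Y' : D} (c : k) (g : Y ⟶ Y'),
      F.map ((𝟙 X, c • g) : (X, Y) ⟶ (X, Y')) = c • F.map ((𝟙 X, g) : (X, Y) ⟶ (X, Y'))) :
    ∃ ι : ∀ X : D, F.obj (op X, X) ⟶ ⨁ fun i => F.obj (op (s i), s i),
      IsCoend F ι ∧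
        ∀ i : ιS, ι (s i) = biproduct.ι (fun i => F.obj (op (s i), s i)) i := by
  have hF : IsBiadditive F := ⟨hadd₁, hadd₂⟩
  have hκ (i j : ιS) (u : s i ⟶ s j) :
      F.map ((u.op, 𝟙 (s i)) : (op (s j), s i) ⟶ (op (s i), s i)) ≫
          biproduct.ι (fun i => F.obj (op (s i), s i)) i =
        F.map ((𝟙 (op (s j)), u) : (op (s j), s i) ⟶ (op (s j), s j)) ≫
          biproduct.ι (fun i => F.obj (op (s i), s i)) j := by
    by_cases hij : i = j
    · subst hij
      obtain ⟨c, rfl, -⟩ := hsimple i u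
      rw [hsmul₁, hsmul₂]
      rfl
    · rw [hzero i j hij u, ← zero_smul k (0 : s i ⟶ s j), hsmul₁, hsmul₂]
      simp
  have hd (X : D) : Nonempty (IdentityDecomposition s X) := by
    obtain ⟨_, g, ⟨e⟩⟩ := hgen X
    exact ⟨.ofIso g e⟩
  let d (X : D) := (hd X).some
  have hs (i : ιS) : (d (s i)).extend F (biproduct.ι fun i => F.obj (op (s i), s i)) =
      biproduct.ι (fun i => F.obj (op (s i), s i)) i :=
    (d (s i)).extend_eq hF _ fun j u => hκ j i u
  refine ⟨fun X => (d X).extend F (biproduct.ι _),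
    ⟨IdentityDecomposition.extend_dinatural hF hκ d, fun e η hη => ?_⟩, hs⟩
  refine ⟨biproduct.desc fun i => η (s i), fun X => ?_, fun q hq => ?_⟩
  · rw [← (d X).extend_eq (κ := fun i => η (s i)) hF (η X) fun i u => hη u]
    simp [IdentityDecomposition.extend, Preadditive.sum_comp]
  · refine biproduct.hom_ext' _ _ fun i => ?_
    rw [biproduct.ι_desc, hq (s i), ← hs i]
end
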